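/- (Dir Lemma) In a regular run, suppose [α,β) with α > 0 is a maximal positive interval of SafeToOpen, i.e., SafeToOpen fails throughout some nonempty interval (α−ε,α), holds throughout [α,β), and fails at β. Then: (1) Dir(α) = close; (2) Dir = open throughout (α,β] and throughout some nonempty interval (β, β+ε'). -/

import Mathlib

namespace RailCross

inductive TStat : Type
  | emp | coming | incrossing
deriving DecidableEq

inductive DirV : Type
  | opn | cls
deriving DecidableEq

inductive GateV : Type
  | opened | closed
deriving DecidableEq

/-- `f` is piecewise constant on `[0, ∞)`: for every `τ > 0` there is a finite
partition `0 = s 0 < s 1 < … < s n = τ` such that `f` is constant on each open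
subinterval `(s i, s (i+1))`. -/
def PWC {Y : Type*} (f : ℝ → Y) : Prop :=
  ∀ τ : ℝ, 0 < τ → ∃ n : ℕ, ∃ s : ℕ → ℝ,
    s 0 = 0 ∧ s n = τ ∧ (∀ i < n, s i < s (i + 1)) ∧
    (∀ i < n, ∀ a b : ℝ, s i < a → a < b → b < s (i + 1) → f a = f b)

/-- `v` is the right-hand value `f(t+)`: `f` is constantly `v` on some `(t, t+ε)`. -/
def RightVal {Y : Type*} (f : ℝ → Y) (t : ℝ) (v : Y) : Prop :=
  ∃ ε : ℝ, 0 < ε ∧ ∀ u : ℝ, t < u → u < t + ε → f u = v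

/-- `v` is the left-hand value `f(t−)` (for `t > 0`): `f` is constantly `v` on some `(t-ε, t)`. -/
def LeftVal {Y : Type*} (f : ℝ → Y) (t : ℝ) (v : Y) : Prop :=
  ∃ ε : ℝ, 0 < ε ∧ ε ≤ t ∧ ∀ u : ℝ, t - ε < u → u < t → f u = v

/-- `tm` is the (finite or infinite) increasing sequence of significant moments of a
track with status function `f`; a finite sequence is encoded by letting `tm` take the
value `⊤ = ∞` from some point on. -/
structure TrainMotion (dmin dmax : ℝ) (f : ℝ → TStat) (tm : ℕ → EReal) : Prop where
  zero : tm 0 = 0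
  mono : Monotone tm
  strict : ∀ i, tm i ≠ ⊤ → tm i < tm (i + 1)
  last_div : ∀ k, tm k ≠ ⊤ → tm (k + 1) = ⊤ → 3 ∣ k
  status_empty : ∀ i : ℕ, ∀ u : ℝ, tm (3 * i) ≤ (u : EReal) → (u : EReal) < tm (3 * i + 1) →
    f u = TStat.emp
  status_coming : ∀ i : ℕ, ∀ u : ℝ, tm (3 * i + 1) ≤ (u : EReal) → (u : EReal) < tm (3 * i + 2) →
    f u = TStat.coming
  status_cross : ∀ i : ℕ, ∀ u : ℝ, tm (3 * i + 2) ≤ (u : EReal) → (u : EReal) < tm (3 * i + 3) →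
    f u = TStat.incrossing
  gap : ∀ i : ℕ, ∀ a b : ℝ, tm (3 * i + 1) = (a : EReal) → tm (3 * i + 2) = (b : EReal) →
    dmin ≤ b - a ∧ b - a ≤ dmax

/-- `SafeToOpen(t)`: every track is empty or its deadline is more than `dopen` away. -/
def SafeToOpen {Tracks : Type*} (dopen : ℝ) (trackStatus : Tracks → ℝ → TStat)
    (deadline : Tracks → ℝ → EReal) (t : ℝ) : Prop :=
  ∀ x : Tracks, trackStatus x t = TStat.emp ∨ ((t + dopen : ℝ) : EReal) < deadline x t

/-- A regular run of the railroad-crossing evolving algebra.  `WaitTime = dmin - dclose`. -/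
structure RegularRun (Tracks : Type*) (dmin dmax dopen dclose : ℝ) where
  trackStatus : Tracks → ℝ → TStat
  deadline : Tracks → ℝ → EReal
  dir : ℝ → DirV
  gate : ℝ → GateV
  /-- the right-hand value `Deadline(x, t+)` -/
  deadlinePlus : Tracks → ℝ → EReal
  /-- the right-hand value `Dir(t+)` -/
  dirPlus : ℝ → DirV
  /-- the right-hand value `GateStatus(t+)` -/
  gatePlus : ℝ → GateV
  pwc_ts : ∀ x, PWC (trackStatus x)
  pwc_dl : ∀ x, PWC (deadline x)
  pwc_dir : PWC dir
  pwc_gate : PWC gate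
  dlPlus_spec : ∀ x, ∀ t : ℝ, 0 ≤ t → RightVal (deadline x) t (deadlinePlus x t)
  dirPlus_spec : ∀ t : ℝ, 0 ≤ t → RightVal dir t (dirPlus t)
  gatePlus_spec : ∀ t : ℝ, 0 ≤ t → RightVal gate t (gatePlus t)
  dl_left : ∀ x, ∀ t : ℝ, 0 < t → LeftVal (deadline x) t (deadline x t)
  dir_left : ∀ t : ℝ, 0 < t → LeftVal dir t (dir t)
  gate_left : ∀ t : ℝ, 0 < t → LeftVal gate t (gate t)
  trainMotion : ∀ x, ∃ tm : ℕ → EReal, TrainMotion dmin dmax (trackStatus x) tm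
  dl_init : ∀ x, deadline x 0 = ⊤
  dir_init : dir 0 = DirV.opn
  gate_init : gate 0 = GateV.opened
  dl_step_coming : ∀ x, ∀ t : ℝ, 0 ≤ t → trackStatus x t = TStat.coming → deadline x t = ⊤ →
    deadlinePlus x t = ((t + (dmin - dclose) : ℝ) : EReal)
  dl_step_empty : ∀ x, ∀ t : ℝ, 0 ≤ t → trackStatus x t = TStat.emp → deadline x t ≠ ⊤ →
    deadlinePlus x t = ⊤
  dl_step_other : ∀ x, ∀ t : ℝ, 0 ≤ t →
    ¬(trackStatus x t = TStat.coming ∧ deadline x t = ⊤) →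
    ¬(trackStatus x t = TStat.emp ∧ deadline x t ≠ ⊤) →
    deadlinePlus x t = deadline x t
  dir_step_close : ∀ t : ℝ, 0 ≤ t → (∃ x, deadline x t = (t : EReal)) → dirPlus t = DirV.cls
  dir_step_open : ∀ t : ℝ, 0 ≤ t → (∀ x, deadline x t ≠ (t : EReal)) → dir t = DirV.cls →
    SafeToOpen dopen trackStatus deadline t → dirPlus t = DirV.opn
  dir_step_other : ∀ t : ℝ, 0 ≤ t → (∀ x, deadline x t ≠ (t : EReal)) →
    ¬(dir t = DirV.cls ∧ SafeToOpen dopen trackStatus deadline t) → dirPlus t = dir t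
  gate_step : ∀ t : ℝ, 0 ≤ t →
    gatePlus t = gate t ∨ (dir t = DirV.opn ∧ gatePlus t = GateV.opened) ∨
      (dir t = DirV.cls ∧ gatePlus t = GateV.closed)
  gate_close_bound : ∀ t : ℝ, 0 ≤ t →
    ¬(∀ u ∈ Set.Ioo t (t + dclose), dir u = DirV.cls ∧ gate u = GateV.opened)
  gate_open_bound : ∀ t : ℝ, 0 ≤ t →
    ¬(∀ u ∈ Set.Ioo t (t + dopen), dir u = DirV.opn ∧ gate u = GateV.closed)

/-- A left-continuous function with right-hand values that starts at `v` to the right of `a` and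
never leaves `v` at a moment of `(a, b)` is equal to `v` on `(a, b]`. -/
theorem eq_on_Ioc_of_step {Y : Type*} {f fp : ℝ → Y} {v : Y} {a b : ℝ} (ha : 0 ≤ a)
    (hleft : ∀ t, 0 < t → LeftVal f t (f t)) (hright : ∀ t, 0 ≤ t → RightVal f t (fp t))
    (hstart : fp a = v) (hstep : ∀ t, a < t → t < b → f t = v → fp t = v) :
    ∀ u, a < u → u ≤ b → f u = v := by
  by_contra! ⟨u, hau, hub, hu⟩
  set B : Set ℝ := {u | a < u ∧ u ≤ b ∧ f u ≠ v} with hB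
  have hne : B.Nonempty := ⟨u, hau, hub, hu⟩
  have hbdd : BddBelow B := ⟨a, fun x hx => hx.1.le⟩
  have hac : a ≤ sInf B := le_csInf hne fun x hx => hx.1.le
  have hcb : sInf B ≤ b := (csInf_le hbdd ⟨hau, hub, hu⟩).trans hub
  have hbelow : ∀ w, a < w → w < sInf B → f w = v := by
    intro w haw hw
    by_contra hfw
    exact absurd (csInf_le hbdd (show w ∈ B from ⟨haw, hw.le.trans hcb, hfw⟩)) (not_le.2 hw)
  have hat : a < sInf B → f (sInf B) = v := by
    intro h
    obtain ⟨ε, hε, -, hεf⟩ := hleft (sInf B) (ha.trans_lt h)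
    obtain ⟨w, hw, hwc⟩ := exists_between (max_lt h (sub_lt_self (sInf B) hε))
    rw [← hεf w ((le_max_right _ _).trans_lt hw) hwc]
    exact hbelow w ((le_max_left _ _).trans_lt hw) hwc
  have hlt : sInf B < b := by
    refine lt_of_le_of_ne hcb fun h => hu ?_
    rcases hub.lt_or_eq with h' | h'
    · exact hbelow u hau (h ▸ h')
    · rw [h', ← h]
      exact hat (h ▸ h' ▸ hau)
  have hplus : fp (sInf B) = v := by
    rcases hac.lt_or_eq with h | h
    · exact hstep _ h hlt (hat h)
    · rw [← h, hstart]
  obtain ⟨ε, hε, hεf⟩ := hright (sInf B) (ha.trans hac)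
  have : sInf B + ε ≤ sInf B := by
    refine le_csInf hne fun w hw => ?_
    by_contra! hwε
    rcases (csInf_le hbdd hw).lt_or_eq with h | h
    · exact hw.2.2 ((hεf w h hwε).trans hplus)
    · exact hw.2.2 (h ▸ hat (h ▸ hw.1))
  linarith

namespace TrainMotion

variable {dmin dmax : ℝ} {f : ℝ → TStat} {tm : ℕ → EReal}

theorem exists_eq_coe (h : TrainMotion dmin dmax f tm) {n : ℕ} (hn : tm n ≠ ⊤) :
    ∃ r : ℝ, 0 ≤ r ∧ tm n = r := by
  have h0 : 0 ≤ tm n := h.zero ▸ h.mono (Nat.zero_le n)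
  have hb : tm n ≠ ⊥ := fun hb => by simp [hb] at h0
  refine ⟨(tm n).toReal, EReal.toReal_nonneg h0, (EReal.coe_toReal hn hb).symm⟩

theorem exists_coming_bounds (h : TrainMotion dmin dmax f tm) {i : ℕ}
    (hi : tm (3 * i + 1) ≠ ⊤) :
    ∃ a b : ℝ, 0 ≤ a ∧ tm (3 * i + 1) = a ∧ tm (3 * i + 2) = b ∧ dmin ≤ b - a := by
  have h2 : tm (3 * i + 2) ≠ ⊤ := fun h2 => by
    have := h.last_div _ hi h2
    omega
  obtain ⟨a, ha, hae⟩ := h.exists_eq_coe hi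
  obtain ⟨b, -, hbe⟩ := h.exists_eq_coe h2
  exact ⟨a, b, ha, hae, hbe, (h.gap i a b hae hbe).1⟩

theorem mul_le_moment (h : TrainMotion dmin dmax f tm) (i : ℕ) :
    ((i * dmin : ℝ) : EReal) ≤ tm (3 * i) := by
  induction i with
  | zero => simp [h.zero]
  | succ i ih =>
    by_cases h1 : tm (3 * i + 1) = ⊤
    · have : tm (3 * i + 1) ≤ tm (3 * (i + 1)) := h.mono (by omega)
      rw [h1, top_le_iff] at this
      simp [this]
    · obtain ⟨a, b, -, ha, hb, hab⟩ := h.exists_coming_bounds h1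
      have hia : ((i * dmin : ℝ) : EReal) ≤ a := ih.trans (ha ▸ h.mono (by omega))
      have hb3 : (b : EReal) ≤ tm (3 * (i + 1)) := hb ▸ h.mono (by omega)
      refine le_trans (EReal.coe_le_coe_iff.2 ?_) hb3
      have := EReal.coe_le_coe_iff.1 hia
      push_cast
      linarith

theorem exists_cycle (h : TrainMotion dmin dmax f tm) (hdmin : 0 < dmin) {t : ℝ} (ht : 0 < t) :
    ∃ i : ℕ, tm (3 * i) < t ∧ (t : EReal) ≤ tm (3 * i + 3) := by
  classical
  have hex : ∃ i : ℕ, (t : EReal) ≤ tm (3 * i) := by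
    obtain ⟨i, hi⟩ := exists_nat_ge (t / dmin)
    exact ⟨i, (EReal.coe_le_coe_iff.2 ((div_le_iff₀ hdmin).1 hi)).trans (h.mul_le_moment i)⟩
  have hspec := Nat.find_spec hex
  rcases hj : Nat.find hex with _ | j
  · rw [hj, Nat.mul_zero, h.zero] at hspec
    exact absurd (by exact_mod_cast hspec) (not_le.2 ht)
  · rw [hj] at hspec
    exact ⟨j, not_le.1 (Nat.find_min hex (by omega)), hspec⟩

end TrainMotion

namespace RegularRun

variable {Tracks : Type*} {dmin dmax dopen dclose : ℝ}

theorem deadlinePlus_eq_top_of_empty (R : RegularRun Tracks dmin dmax dopen dclose) {x : Tracks}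
    {t : ℝ} (ht : 0 ≤ t) (hs : R.trackStatus x t = TStat.emp) : R.deadlinePlus x t = ⊤ := by
  by_cases hd : R.deadline x t = ⊤
  · rw [R.dl_step_other x t ht (by simp [hs]) (by simp [hd]), hd]
  · exact R.dl_step_empty x t ht hs hd

/-- At a moment `t > 0` a track is either at the end of a nondegenerate empty period, and has no
deadline, or has been nonempty since the arrival of a train at some moment `a < t` and still has
the deadline set for that train. -/
theorem track_history (R : RegularRun Tracks dmin dmax dopen dclose) (hdmin : 0 < dmin)
    (hdclose : 0 < dclose) (x : Tracks) {t : ℝ} (ht : 0 < t) :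
    ∃ a, 0 ≤ a ∧ a < t ∧
      (((∀ u, a < u → u < t → R.trackStatus x u = TStat.emp) ∧ R.deadline x t = ⊤) ∨
       ((∀ u, a < u → u < t → R.trackStatus x u ≠ TStat.emp) ∧
        (∀ u, a < u → u ≤ t → R.deadline x u = ((a + (dmin - dclose) : ℝ) : EReal)) ∧
        (R.trackStatus x t = TStat.emp → a + (dmin - dclose) < t))) := by
  obtain ⟨tm, h⟩ := R.trainMotion x
  obtain ⟨i, hi, hi3⟩ := h.exists_cycle hdmin ht
  obtain ⟨e, he, hei⟩ := h.exists_eq_coe (ne_top_of_lt hi)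
  have hempty : ∀ u : ℝ, e ≤ u → (u : EReal) < tm (3 * i + 1) → R.trackStatus x u = TStat.emp :=
    fun u hu hu1 => h.status_empty i u (hei ▸ EReal.coe_le_coe_iff.2 hu) hu1
  have hei1 : (e : EReal) < tm (3 * i + 1) := hei ▸ h.strict _ (ne_top_of_lt hi)
  have htop : ∀ u : ℝ, e < u → (u : EReal) ≤ tm (3 * i + 1) → R.deadline x u = ⊤ := by
    intro u hu hu1
    refine eq_on_Ioc_of_step he (R.dl_left x) (R.dlPlus_spec x)
      (R.deadlinePlus_eq_top_of_empty he (hempty e le_rfl hei1)) (fun w hew hwu _ => ?_) u hu le_rfl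
    exact R.deadlinePlus_eq_top_of_empty (he.trans hew.le)
      (hempty w hew.le ((EReal.coe_lt_coe_iff.2 hwu).trans_le hu1))
  rcases le_or_gt (t : EReal) (tm (3 * i + 1)) with ht1 | ht1
  · rw [hei, EReal.coe_lt_coe_iff] at hi
    exact ⟨e, he, hi, .inl ⟨fun u hu hut =>
      hempty u hu.le ((EReal.coe_lt_coe_iff.2 hut).trans_le ht1), htop t hi ht1⟩⟩
  · obtain ⟨a, b, ha, hai, hbi, hab⟩ := h.exists_coming_bounds (ne_top_of_lt ht1)
    have hbi3 : (b : EReal) < tm (3 * i + 3) := hbi ▸ h.strict _ (by simp [hbi])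
    have hea : e < a := EReal.coe_lt_coe_iff.1 (hai ▸ hei1)
    have hat : a < t := EReal.coe_lt_coe_iff.1 (hai ▸ ht1)
    have hcoming : R.trackStatus x a = TStat.coming :=
      h.status_coming i a hai.le (hbi ▸ EReal.coe_lt_coe_iff.2 (by linarith))
    have hnonempty : ∀ u : ℝ, a ≤ u → (u : EReal) < tm (3 * i + 3) →
        R.trackStatus x u ≠ TStat.emp := by
      intro u hau hu3
      rcases lt_or_ge u b with hub | hub
      · rw [h.status_coming i u (hai ▸ EReal.coe_le_coe_iff.2 hau)
          (hbi ▸ EReal.coe_lt_coe_iff.2 hub)]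
        simp
      · rw [h.status_cross i u (hbi ▸ EReal.coe_le_coe_iff.2 hub) hu3]
        simp
    refine ⟨a, ha, hat, .inr ⟨fun u hau hut =>
      hnonempty u hau.le ((EReal.coe_lt_coe_iff.2 hut).trans_le hi3), ?_, fun hs => ?_⟩⟩
    · refine eq_on_Ioc_of_step ha (R.dl_left x) (R.dlPlus_spec x)
        (R.dl_step_coming x a ha hcoming (htop a hea hai.ge)) (fun w haw hwt hw => ?_)
      rw [R.dl_step_other x w (ha.trans haw.le) (by simp [hw, -EReal.coe_add, -EReal.coe_sub])
        (fun hs => hnonempty w haw.le ((EReal.coe_lt_coe_iff.2 hwt).trans_le hi3) hs.1), hw]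
    · have htb : b < t := by
        by_contra! htb
        exact hnonempty t hat.le ((EReal.coe_le_coe_iff.2 htb).trans_lt hbi3) hs
      linarith

theorem deadline_ne_self_of_safe (R : RegularRun Tracks dmin dmax dopen dclose) (hdmin : 0 < dmin)
    (hdopen : 0 < dopen) (hdclose : 0 < dclose) {t : ℝ} (ht : 0 < t)
    (hsafe : SafeToOpen dopen R.trackStatus R.deadline t) (x : Tracks) :
    R.deadline x t ≠ (t : EReal) := by
  intro heq
  rcases hsafe x with hs | hs
  · obtain ⟨a, -, hat, ⟨-, htop⟩ | ⟨-, hd, hlt⟩⟩ := R.track_history hdmin hdclose x ht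
    · simp [htop] at heq
    · rw [hd t hat le_rfl, EReal.coe_eq_coe_iff] at heq
      linarith [hlt hs]
  · rw [heq, EReal.coe_lt_coe_iff] at hs
    linarith

theorem deadline_ne_self_of_safe_before (R : RegularRun Tracks dmin dmax dopen dclose)
    (hdmin : 0 < dmin) (hdopen : 0 < dopen) (hdclose : 0 < dclose) {α β : ℝ} (hβ : 0 < β)
    (hαβ : α < β) (hsafe : ∀ u ∈ Set.Ico α β, SafeToOpen dopen R.trackStatus R.deadline u)
    (x : Tracks) : R.deadline x β ≠ (β : EReal) := by
  intro heq
  obtain ⟨a, -, haβ, ⟨-, htop⟩ | ⟨hs, hd, -⟩⟩ := R.track_history hdmin hdclose x hβ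
  · simp [htop] at heq
  · obtain ⟨u, hu, huβ⟩ := exists_between (max_lt (max_lt haβ hαβ) (sub_lt_self β hdopen))
    simp only [max_lt_iff] at hu
    obtain ⟨⟨hau, hαu⟩, hu⟩ := hu
    rcases hsafe u ⟨hαu.le, huβ⟩ x with h | h
    · exact hs u hau huβ h
    · rw [hd u hau huβ.le, ← hd β haβ le_rfl, heq, EReal.coe_lt_coe_iff] at h
      linarith

open Filter Topology in
/-- When the last train leaves a track and this restores safety, the gate has been directed to
close since the expiry of the deadline of that train. -/
theorem dir_eq_cls_of_becomes_safe [Finite Tracks]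
    (R : RegularRun Tracks dmin dmax dopen dclose) (hdmin : 0 < dmin) (hdopen : 0 < dopen)
    (hdclose : 0 < dclose) (hcm : dclose < dmin) {α : ℝ} (hα : 0 < α)
    (hfail : ∃ ε : ℝ, 0 < ε ∧ ε ≤ α ∧ ∀ u : ℝ, α - ε < u → u < α →
      ¬SafeToOpen dopen R.trackStatus R.deadline u)
    (hsafe : SafeToOpen dopen R.trackStatus R.deadline α) : R.dir α = DirV.cls := by
  by_contra hdir
  have hev : ∀ᶠ u in 𝓝[<] α, SafeToOpen dopen R.trackStatus R.deadline u := by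
    refine eventually_all.2 fun x => ?_
    obtain ⟨a, ha, haα, ⟨hs, -⟩ | ⟨hs, hd, hlt⟩⟩ := R.track_history hdmin hdclose x hα
    · filter_upwards [Ioo_mem_nhdsLT haα] with u hu using .inl (hs u hu.1 hu.2)
    · rcases hsafe x with hemp | hdl
      · refine absurd ?_ hdir
        have hlt := hlt hemp
        refine eq_on_Ioc_of_step (a := a + (dmin - dclose)) (by linarith) R.dir_left
          R.dirPlus_spec (R.dir_step_close _ (by linarith) ⟨x, hd _ (by linarith) hlt.le⟩)
          (fun t hat htα ht => ?_) α hlt le_rfl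
        have hat' : a < t := by linarith
        by_cases hx : ∃ y, R.deadline y t = (t : EReal)
        · exact R.dir_step_close t (by linarith) hx
        · rw [R.dir_step_other t (by linarith) (not_exists.1 hx) ?_, ht]
          rintro ⟨-, hst⟩
          rcases hst x with h | h
          · exact hs t hat' htα h
          · rw [hd t hat' htα.le, EReal.coe_lt_coe_iff] at h
            linarith
      · filter_upwards [Ioo_mem_nhdsLT haα] with u hu
        rw [hd α haα le_rfl] at hdl
        rw [hd u hu.1 hu.2.le]
        exact .inr ((EReal.coe_lt_coe_iff.2 (by linarith [hu.2])).trans hdl)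
  obtain ⟨ε, hε, -, hfail⟩ := hfail
  obtain ⟨u, hu, hαu⟩ := (hev.and (Ioo_mem_nhdsLT (sub_lt_self α hε))).exists
  exact hfail u hαu.1 hαu.2 hu

end RegularRun

theorem dir_lemma {Tracks : Type*} [Fintype Tracks] [Nonempty Tracks]
    {dmin dmax dopen dclose : ℝ}
    (hdmin : 0 < dmin) (hdmax : 0 < dmax) (hdopen : 0 < dopen) (hdclose : 0 < dclose)
    (hcm : dclose < dmin) (hmm : dmin ≤ dmax)
    (R : RegularRun Tracks dmin dmax dopen dclose)
    (α β : ℝ) (hα : 0 < α) (hαβ : α < β)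
    (hfail_left : ∃ ε : ℝ, 0 < ε ∧ ε ≤ α ∧ ∀ u : ℝ, α - ε < u → u < α →
      ¬SafeToOpen dopen R.trackStatus R.deadline u)
    (hholds : ∀ u ∈ Set.Ico α β, SafeToOpen dopen R.trackStatus R.deadline u)
    (hfail_β : ¬SafeToOpen dopen R.trackStatus R.deadline β) :
    R.dir α = DirV.cls ∧
    (∀ t ∈ Set.Ioc α β, R.dir t = DirV.opn) ∧
    (∃ ε' : ℝ, 0 < ε' ∧ ∀ t ∈ Set.Ioo β (β + ε'), R.dir t = DirV.opn) := by
  have hcls : R.dir α = DirV.cls :=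
    R.dir_eq_cls_of_becomes_safe hdmin hdopen hdclose hcm hα hfail_left (hholds α ⟨le_rfl, hαβ⟩)
  have hne : ∀ t ∈ Set.Ico α β, ∀ x, R.deadline x t ≠ (t : EReal) := fun t ht =>
    R.deadline_ne_self_of_safe hdmin hdopen hdclose (hα.trans_le ht.1) (hholds t ht)
  have hopen : ∀ t, α < t → t ≤ β → R.dir t = DirV.opn := by
    refine eq_on_Ioc_of_step hα.le R.dir_left R.dirPlus_spec
      (R.dir_step_open α hα.le (hne α ⟨le_rfl, hαβ⟩) hcls (hholds α ⟨le_rfl, hαβ⟩))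
      (fun t hαt htβ ht => ?_)
    rw [R.dir_step_other t (hα.trans hαt).le (hne t ⟨hαt.le, htβ⟩) (by simp [ht]), ht]
  have hβ : 0 < β := hα.trans hαβ
  have hplus : R.dirPlus β = DirV.opn := by
    rw [R.dir_step_other β hβ.le
      (R.deadline_ne_self_of_safe_before hdmin hdopen hdclose hβ hαβ hholds)
      (fun h => hfail_β h.2), hopen β hαβ le_rfl]
  obtain ⟨ε, hε, hεdir⟩ := R.dirPlus_spec β hβ.le
  exact ⟨hcls, fun t ht => hopen t ht.1 ht.2, ε, hε, fun t ht => (hεdir t ht.1 ht.2).trans hplus⟩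

end RailCross
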